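/- Let F be a finite-dimensional C*-algebra, A a C*-algebra, and φ : F → A a positive linear map. If τ is a tracial state on A, then τ ∘ φ is a positive tracial linear functional on F provided φ is a sum of finitely many completely positive order zero maps. In particular, for an order zero cpc map φ, τ ∘ φ is a positive tracial functional on F of norm at most 1. -/

import Mathlib

open scoped Matrix

/-- A linear map between complex star algebras is completely positive if each matrix
amplification sends positive matrices (those of the form `Nᴴ * N`) to positive matrices. -/
def IsCompletelyPositive {A B : Type*} [Ring A] [Ring B] [Algebra ℂ A] [Algebra ℂ B]
    [StarRing A] [StarRing B] (φ : A →ₗ[ℂ] B) : Prop :=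
  ∀ (n : ℕ) (M : Matrix (Fin n) (Fin n) A), (∃ N, M = Nᴴ * N) →
    ∃ N', M.map ⇑φ = N'ᴴ * N'

/-- A map is order zero if it preserves orthogonality of positive elements. -/
def IsOrderZero {F A : Type*} [NonUnitalRing F] [Star F] [NonUnitalRing A] [Star A]
    (φ : F → A) : Prop :=
  ∀ x y : F, (∃ c, x = star c * c) → (∃ c, y = star c * c) → x * y = 0 → φ x * φ y = 0

section Helpers

set_option linter.unusedSectionVars false

variable {A : Type*} [NormedRing A] [StarRing A] [CStarRing A] [NormedAlgebra ℂ A]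

lemma aux_star_real (r : ℝ) (a : A) : star ((r : ℂ) • a) = (r : ℂ) • star a := by
  have h := map_real_smul (starAddEquiv : A ≃+ A) (by exact continuous_star) r a
  simpa using h

/-- The adjoint of the scalar `i`; the star operation is not assumed conjugate linear. -/
noncomputable def auxJ (A : Type*) [NormedRing A] [StarRing A] [NormedAlgebra ℂ A] : A :=
  star (Complex.I • (1 : A))

lemma auxJ_comm (x : A) : auxJ A * x = x * auxJ A := by
  have h : star x * (Complex.I • (1 : A)) = (Complex.I • (1 : A)) * star x := by simp
  have h2 := congrArg star h
  rw [star_mul, star_mul, star_star] at h2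
  exact h2

lemma auxJ_sq : auxJ A * auxJ A = -1 := by
  rw [auxJ, ← star_mul]
  simp [smul_smul]

lemma aux_star_I (a : A) : star (Complex.I • a) = auxJ A * star a := by
  rw [auxJ_comm, auxJ, ← star_mul]
  simp

lemma aux_star_smul (z : ℂ) (a : A) :
    star (z • a) = (z.re : ℂ) • star a + (z.im : ℂ) • (auxJ A * star a) := by
  conv_lhs => rw [← Complex.re_add_im z]
  rw [add_smul, star_add, aux_star_real, mul_smul, aux_star_real, aux_star_I]

lemma aux_skew [CompleteSpace A] (k : A) (hk : star k = -k) (hJ : auxJ A * k = Complex.I • k) :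
    k = 0 := by
  let _ : NormedAlgebra ℚ A := NormedAlgebra.restrictScalars ℚ ℂ A
  have hs : ∀ z : ℂ, z • k ∈ skewAdjoint A := by
    intro z
    rw [skewAdjoint.mem_iff, aux_star_smul, hk, mul_neg, hJ]
    conv_rhs => rw [← Complex.re_add_im z]
    rw [add_smul, mul_smul]
    simp only [smul_neg, neg_add]
  have hd : ∀ z : ℂ, HasDerivAt (fun u : ℂ => NormedSpace.exp (u • k))
      (NormedSpace.exp (z • k) * k) z := fun z => hasDerivAt_exp_smul_const k z
  have hb : Bornology.IsBounded (Set.range fun u : ℂ => NormedSpace.exp (u • k)) := by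
    rw [isBounded_iff_forall_norm_le]
    refine ⟨1 + ‖(1 : A)‖, ?_⟩
    rintro _ ⟨u, rfl⟩
    have hu := NormedSpace.exp_mem_unitary_of_mem_skewAdjoint (hs u)
    have h1 := CStarRing.norm_star_mul_self (x := NormedSpace.exp (u • k))
    rw [(Unitary.mem_iff.mp hu).1] at h1
    dsimp only
    nlinarith [norm_nonneg (NormedSpace.exp (u • k)), norm_nonneg (1 : A)]
  have hc : (fun u : ℂ => NormedSpace.exp (u • k)) = fun _ => 1 := by
    funext u
    have := Differentiable.apply_eq_apply_of_bounded
      (fun z => (hd z).differentiableAt) hb u 0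
    simpa using this
  have h0 := hd 0
  rw [hc] at h0
  have := h0.unique (hasDerivAt_const (0 : ℂ) (1 : A))
  simpa using this

lemma aux_sqrt [CompleteSpace A] (s : A) (hs : star s = s) (h1 : ‖s‖ < 1) :
    ∃ w : A, star w = w ∧ w * w = 1 - s := by
  let f : A → A := fun y => ((1 / 2 : ℝ) : ℂ) • (s + y * y)
  let S : Set A := {y | star y = y} ∩ Metric.closedBall 0 ‖s‖
  have hSc : IsComplete S := by
    apply IsClosed.isComplete
    exact (isClosed_eq continuous_star continuous_id).inter Metric.isClosed_closedBall
  have hn : ‖((1 / 2 : ℝ) : ℂ)‖ = 1 / 2 := by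
    rw [Complex.norm_real]; norm_num
  have hmap : Set.MapsTo f S S := by
    rintro y ⟨hy1, hy2⟩
    have hy1 : star y = y := hy1
    refine ⟨?_, ?_⟩
    · change star (f y) = f y
      simp only [f, aux_star_real, star_add, star_mul, hs, hy1]
    · rw [mem_closedBall_zero_iff] at hy2 ⊢
      simp only [f]
      rw [norm_smul, hn]
      have h2 := norm_add_le s (y * y)
      have h3 := norm_mul_le y y
      nlinarith [norm_nonneg y, norm_nonneg s]
  have hcon : ContractingWith ‖s‖₊ (hmap.restrict f S S) := by
    refine ⟨by exact_mod_cast h1, LipschitzWith.of_dist_le_mul ?_⟩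
    rintro ⟨y, hy1, hy⟩ ⟨z, hz1, hz⟩
    rw [mem_closedBall_zero_iff] at hy hz
    change dist (f y) (f z) ≤ ‖s‖ * dist y z
    rw [dist_eq_norm, dist_eq_norm]
    have : f y - f z = ((1 / 2 : ℝ) : ℂ) • (y * (y - z) + (y - z) * z) := by
      simp only [f]
      rw [← smul_sub]
      congr 1
      noncomm_ring
    rw [this, norm_smul, hn]
    have h2 := norm_add_le (y * (y - z)) ((y - z) * z)
    have h3 := norm_mul_le y (y - z)
    have h4 := norm_mul_le (y - z) z
    nlinarith [norm_nonneg (y - z)]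
  obtain ⟨y, hyS, hfix, -⟩ := hcon.exists_fixedPoint' hSc hmap (x := 0)
    ⟨by simp, by simp⟩ (edist_ne_top _ _)
  have hy1 : star y = y := hyS.1
  refine ⟨1 - y, by simp [hy1], ?_⟩
  have hf : ((1 / 2 : ℝ) : ℂ) • (s + y * y) = y := hfix
  have h2 : s + y * y = y + y := by
    have h3 := congrArg (fun t => (2 : ℂ) • t) hf
    simp only [smul_smul] at h3
    rw [two_smul] at h3
    norm_num at h3
    exact h3
  have : (1 - y) * (1 - y) = 1 - (y + y) + y * y := by noncomm_ring
  rw [this, ← h2]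
  abel

section Trace

variable [CompleteSpace A] (τ : A →ₗ[ℂ] ℂ)

lemma aux_tau_J
    (hτpos : ∀ a : A, 0 ≤ (τ (star a * a)).re ∧ (τ (star a * a)).im = 0)
    (b : A) : τ (auxJ A * b) = -(Complex.I * τ b) := by
  -- elements on which `J` acts as `i` are selfadjoint and killed by `τ`
  have key : ∀ a : A, auxJ A * a = Complex.I • a → star a = a := by
    intro a ha
    have ha' : auxJ A * star a = Complex.I • star a := by
      have h1 := congrArg star ha
      rw [aux_star_I, star_mul, auxJ, star_star] at h1
      rw [auxJ, ← h1]; simp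
    have := aux_skew (star a - a) (by simp) (by rw [mul_sub, ha, ha', smul_sub])
    exact sub_eq_zero.mp this
  have hsm : ∀ a : A, auxJ A * a = Complex.I • a → τ (a * a) = 0 := by
    intro a ha
    have h1 := hτpos a
    have h2 := hτpos (Complex.I • a)
    rw [key a ha] at h1
    rw [key (Complex.I • a) (by rw [mul_smul_comm, ha])] at h2
    have h3 : (Complex.I • a) * (Complex.I • a) = -(a * a) := by
      simp [smul_smul]
    rw [h3, map_neg, Complex.neg_re] at h2
    apply Complex.ext
    · simp; linarith
    · simpa using h1.2
  have hz : ∀ c : A, τ (c - Complex.I • (auxJ A * c)) = 0 := by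
    intro c
    have hJ : ∀ c : A, auxJ A * (c - Complex.I • (auxJ A * c)) =
        Complex.I • (c - Complex.I • (auxJ A * c)) := by
      intro c
      rw [mul_sub, mul_smul_comm, ← mul_assoc, auxJ_sq, smul_sub, smul_smul, Complex.I_mul_I]
      simp only [neg_mul, one_mul, smul_neg, neg_smul, one_smul]
      abel
    set e : A := (1 / 2 : ℂ) • (1 - Complex.I • (auxJ A * 1)) with he
    set d : A := c - Complex.I • (auxJ A * c) with hd
    have hed : e * d = d := by
      have : (Complex.I • (auxJ A * 1)) * d = - d := by
        rw [mul_one, smul_mul_assoc, hJ c, smul_smul, Complex.I_mul_I, neg_one_smul]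
      rw [he, smul_mul_assoc, sub_mul, this, one_mul, sub_neg_eq_add, ← two_smul ℂ d, smul_smul]
      norm_num
    have hde : d * e = d := by
      have : d * (Complex.I • (auxJ A * 1)) = - d := by
        rw [mul_one, mul_smul_comm, ← auxJ_comm, hJ c, smul_smul, Complex.I_mul_I, neg_one_smul]
      rw [he, mul_smul_comm, mul_sub, this, mul_one, sub_neg_eq_add, ← two_smul ℂ d, smul_smul]
      norm_num
    have hJe : auxJ A * e = Complex.I • e := by
      rw [he, mul_smul_comm, hJ 1, smul_comm]
    have h1 := hsm e hJe
    have h2 := hsm d (hJ c)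
    have h3 := hsm (e + d) (by rw [mul_add, hJe, hJ c, smul_add])
    have h4 : (e + d) * (e + d) = e * e + d * d + (2 : ℂ) • d := by
      rw [two_smul]
      rw [add_mul, mul_add, mul_add, hed, hde]
      abel
    rw [h4, map_add, map_add, h1, h2, map_smul] at h3
    simpa using h3
  have h := hz b
  rw [map_sub, map_smul, smul_eq_mul] at h
  linear_combination Complex.I * h + τ (auxJ A * b) * Complex.I_mul_I

lemma aux_tau_star
    (hτpos : ∀ a : A, 0 ≤ (τ (star a * a)).re ∧ (τ (star a * a)).im = 0)
    (b : A) : τ (star b) = star (τ b) := by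
  have h0 := (hτpos b).2
  have h1 := (hτpos (1 + b)).2
  have h2 := (hτpos (Complex.I • 1 + b)).2
  have h3 := (hτpos 1).2
  have e1 : star (1 + b) * (1 + b) = star (1 : A) * 1 + star b * b + (b + star b) := by
    rw [star_add, star_one]; noncomm_ring
  have e2 : star (Complex.I • (1 : A) + b) * (Complex.I • 1 + b)
      = auxJ A * (Complex.I • (1 : A)) + star b * b + (auxJ A * b + Complex.I • star b) := by
    rw [star_add, aux_star_I, star_one, mul_one, add_mul, mul_add, mul_add]
    simp only [mul_smul_comm, mul_one]
    abel
  rw [e1] at h1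
  rw [e2] at h2
  simp only [map_add, map_smul, aux_tau_J τ hτpos, Complex.add_im] at h1 h2
  rw [h0, h3] at h1
  rw [h0] at h2
  have h4 : (τ 1).im = 0 := by simpa using h3
  simp [Complex.mul_re, Complex.mul_im, h4] at h1 h2
  apply Complex.ext
  · simp; linarith
  · simp; linarith

lemma aux_null
    (hτpos : ∀ a : A, 0 ≤ (τ (star a * a)).re ∧ (τ (star a * a)).im = 0)
    (hτ1 : τ 1 = 1)
    (y : A) (hy : τ (star y * y) = 0) : τ y = 0 := by
  have hre : ∀ y : A, τ (star y * y) = 0 → (τ y).re = 0 := by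
    intro y hy
    have h : ∀ s : ℝ, 0 ≤ s * s + 2 * s * (τ y).re := by
      intro s
      have h1 := (hτpos ((s : ℂ) • 1 + y)).1
      have e1 : star ((s : ℂ) • (1 : A) + y) * ((s : ℂ) • 1 + y)
        = ((s : ℂ) * s) • (1 : A) + (s : ℂ) • (y + star y) + star y * y := by
        rw [star_add, aux_star_real, star_one, add_mul, mul_add, mul_add]
        simp only [mul_smul_comm, smul_mul_assoc, mul_one, one_mul, smul_smul, smul_add]
        abel
      rw [e1] at h1
      simp only [map_add, map_smul, hy, hτ1, aux_tau_star τ hτpos] at h1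
      simp at h1
      linarith
    have := h (-(τ y).re)
    nlinarith [sq_nonneg (τ y).re]
  have h2 := hre (Complex.I • y) (by
    rw [aux_star_I, mul_assoc, aux_tau_J τ hτpos, mul_smul_comm, map_smul, hy]; simp)
  have h1 := hre y hy
  apply Complex.ext
  · simpa using h1
  · simpa using h2

lemma aux_norm
    (hτpos : ∀ a : A, 0 ≤ (τ (star a * a)).re ∧ (τ (star a * a)).im = 0)
    (hτ1 : τ 1 = 1) (a : A) (ha : ‖a‖ ≤ 1) : ‖τ a‖ ≤ 1 := by
  have hsa : ∀ s : A, star s = s → ‖s‖ < 1 → (τ s).re ≤ 1 := by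
    intro s hs h1
    obtain ⟨w, hw, hww⟩ := aux_sqrt s hs h1
    have := (hτpos w).1
    rw [hw, hww, map_sub, hτ1] at this
    simpa using this
  have hlt : ∀ b : A, ‖b‖ < 1 → (τ b).re ≤ 1 := by
    intro b hb
    have h := hsa (((1 / 2 : ℝ) : ℂ) • (b + star b))
      (by rw [aux_star_real, star_add, star_star, add_comm]) (by
        have hn : ‖((1 / 2 : ℝ) : ℂ)‖ = 1 / 2 := by
          rw [Complex.norm_real]; norm_num
        rw [norm_smul, hn]
        have := norm_add_le b (star b)
        rw [norm_star] at this
        linarith)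
    rw [map_smul, map_add, aux_tau_star τ hτpos, smul_eq_mul, Complex.re_ofReal_mul] at h
    simp at h
    linarith
  by_contra hcon
  push Not at hcon
  set t := ‖τ a‖ with ht
  have ht0 : t ≠ 0 := by positivity
  -- choose a scalar of norm strictly between `1 / t` and `1`
  obtain ⟨c, hc1, hc2⟩ := exists_between hcon
  set z : ℂ := (c / (t * t) : ℝ) • star (τ a) with hz
  have hc0 : 0 < c := by linarith
  have htp : 0 < t := by linarith
  have hzn : ‖z‖ = c / t := by
    rw [hz, norm_smul, norm_star, ← ht, Real.norm_of_nonneg (by positivity)]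
    field_simp
  have hzl : ‖z‖ < 1 := by
    rw [hzn, div_lt_one htp]; exact hc2
  have h := hlt (z • a) (by
    rw [norm_smul]
    nlinarith [norm_nonneg z, norm_nonneg a])
  have hv : τ (z • a) = (c : ℂ) := by
    rw [map_smul, hz, smul_eq_mul, smul_mul_assoc]
    have : star (τ a) * τ a = ((t * t : ℝ) : ℂ) := by
      rw [Complex.star_def, mul_comm, Complex.mul_conj, Complex.normSq_eq_norm_sq, ← ht, sq]
    rw [this, Complex.real_smul, ← Complex.ofReal_mul]
    congr 1
    field_simp
  rw [hv] at h
  simp at h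
  linarith

end Trace

lemma aux_semisimple [FiniteDimensional ℂ A] : IsSemisimpleRing A := by
  have : IsArtinianRing A := IsArtinianRing.of_finite ℂ A
  rw [IsArtinianRing.isSemisimpleRing_iff_jacobson, eq_bot_iff]
  intro x hx
  obtain ⟨n, hn⟩ := IsSemiprimaryRing.isNilpotent (R := A)
  have hxx : star x * x ∈ Ring.jacobson A := Ideal.mul_mem_left _ _ hx
  have hp : (star x * x) ^ (2 ^ n) = 0 := by
    have h1 := Ideal.pow_mem_pow hxx n
    rw [hn] at h1
    have h1 : (star x * x) ^ n = 0 := h1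
    exact pow_eq_zero_of_le Nat.lt_two_pow_self.le h1
  have h2 := (IsSelfAdjoint.star_mul_self x).nnnorm_pow_two_pow n
  rw [hp, nnnorm_zero] at h2
  have h3 := (pow_eq_zero_iff (by positivity)).mp h2.symm
  rw [nnnorm_eq_zero, CStarRing.star_mul_self_eq_zero_iff] at h3
  simpa using h3

end Helpers

lemma aux_pi_tracial {n : ℕ} {d : Fin n → ℕ}
    (g : (Π i, Matrix (Fin (d i)) (Fin (d i)) ℂ) →ₗ[ℂ] ℂ)
    (hg : ∀ x y, x * y = 0 → g (y * x) = 0) (x y) : g (x * y) = g (y * x) := by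
  have hid : ∀ p, p * p = p → g (x * p) = g (p * x) := by
    intro p hp
    have h1 := hg p ((1 - p) * x) (by rw [← mul_assoc, mul_sub, hp]; simp)
    have h2 := hg (1 - p) (p * x) (by rw [← mul_assoc, sub_mul, hp]; simp)
    have e1 : (1 - p) * x * p = x * p - p * x * p := by noncomm_ring
    have e2 : p * x * (1 - p) = p * x - p * x * p := by noncomm_ring
    rw [e1, map_sub] at h1
    rw [e2, map_sub] at h2
    linear_combination h1 - h2
  let L : (Π i, Matrix (Fin (d i)) (Fin (d i)) ℂ) →ₗ[ℂ] ℂ :=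
    g ∘ₗ LinearMap.mulLeft ℂ x - g ∘ₗ LinearMap.mulRight ℂ x
  have hL : ∀ p, p * p = p → L p = 0 := fun p hp => by
    simp [L, hid p hp]
  suffices h : L y = 0 by
    simpa [L, sub_eq_zero] using h
  rw [← Finset.univ_sum_single y, map_sum]
  refine Finset.sum_eq_zero fun i _ => ?_
  have hL' : ∀ q : Matrix (Fin (d i)) (Fin (d i)) ℂ, q * q = q → L (Pi.single i q) = 0 :=
    fun q hq => hL _ (by rw [← Pi.single_mul, hq])
  let Li : Matrix (Fin (d i)) (Fin (d i)) ℂ →ₗ[ℂ] ℂ := L ∘ₗ LinearMap.single ℂ (fun i => Matrix (Fin (d i)) (Fin (d i)) ℂ) i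
  have hLi : ∀ q, q * q = q → Li q = 0 := hL'
  change Li (y i) = 0
  rw [Matrix.matrix_eq_sum_single (y i)]
  simp only [map_sum]
  refine Finset.sum_eq_zero fun a _ => Finset.sum_eq_zero fun b _ => ?_
  have h1 := hLi (Matrix.single a a 1) (by simp)
  by_cases hab : a = b
  · subst hab
    have : Matrix.single a a (y i a a) = (y i a a) • Matrix.single a a (1 : ℂ) := by
      simp [Matrix.smul_single]
    rw [this, map_smul, h1, smul_zero]
  · have h2 := hLi (Matrix.single a a 1 + Matrix.single a b (y i a b)) (by
      rw [add_mul, mul_add, mul_add]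
      simp [Matrix.single_mul_single_of_ne, Ne.symm hab])
    rw [map_add, h1, zero_add] at h2
    exact h2

lemma aux_zero_prod {F A : Type*}
    [NormedRing F] [StarRing F] [CStarRing F] [NormedAlgebra ℂ F]
    [NormedRing A] [StarRing A] [CStarRing A] [NormedAlgebra ℂ A] [CompleteSpace A]
    (τ : A →ₗ[ℂ] ℂ)
    (hτpos : ∀ a : A, 0 ≤ (τ (star a * a)).re ∧ (τ (star a * a)).im = 0)
    (hτtr : ∀ a b : A, τ (a * b) = τ (b * a)) (hτ1 : τ 1 = 1)
    (φ : F →ₗ[ℂ] A) (hcp : IsCompletelyPositive φ) (hoz : IsOrderZero ⇑φ)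
    (x y : F) (hxy : x * y = 0) : τ (φ (y * x)) = 0 := by
  obtain ⟨N, hN⟩ := hcp 2 _ ⟨!![star y, x; 0, 0], rfl⟩
  have e := fun i j => congrFun (congrFun hN i) j
  have e00 := e 0 0
  have e01 := e 0 1
  have e11 := e 1 1
  simp [Matrix.mul_apply, Fin.sum_univ_two, Matrix.conjTranspose_apply] at e00 e01 e11
  have h0 := hoz (y * star y) (star x * x) ⟨star y, by simp⟩ ⟨x, rfl⟩ (by
    have : star y * star x = 0 := by rw [← star_mul, hxy, star_zero]
    rw [mul_assoc, ← mul_assoc (star y), this]; simp)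
  rw [e00, e11] at h0
  -- `τ (∑ X_jk^* X_jk) = 0` for `X_jk = v_j u_k^*`
  have hterm : ∀ j k, τ (star (N j 1 * star (N k 0)) * (N j 1 * star (N k 0)))
      = τ ((star (N k 0) * N k 0) * (star (N j 1) * N j 1)) := by
    intro j k
    rw [star_mul, star_star, hτtr, hτtr (star (N k 0) * N k 0)]
    rw [show N j 1 * star (N k 0) * (N k 0 * star (N j 1))
      = N j 1 * (star (N k 0) * N k 0 * star (N j 1)) by noncomm_ring, hτtr,
      hτtr (star (N j 1) * N j 1)]
    congr 1
    noncomm_ring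
  have hsum := congrArg τ h0
  rw [add_mul, mul_add, mul_add] at hsum
  simp only [map_add, ← hterm, map_zero] at hsum
  have hs := congrArg Complex.re hsum
  simp only [Complex.add_re, Complex.zero_re] at hs
  have p00 := hτpos (N 0 1 * star (N 0 0))
  have p10 := hτpos (N 1 1 * star (N 0 0))
  have p01 := hτpos (N 0 1 * star (N 1 0))
  have p11 := hτpos (N 1 1 * star (N 1 0))
  have q0 := aux_null τ hτpos hτ1 (N 0 1 * star (N 0 0))
    (Complex.ext (by simp only [Complex.zero_re]; linarith [p00.1, p10.1, p01.1, p11.1]) p00.2)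
  have q1 := aux_null τ hτpos hτ1 (N 1 1 * star (N 1 0))
    (Complex.ext (by simp only [Complex.zero_re]; linarith [p00.1, p10.1, p01.1, p11.1]) p11.2)
  rw [e01, map_add, hτtr, q0, hτtr, q1, add_zero]

/-- If `τ` is a tracial state on a unital C*-algebra `A` and
`φ = Σ φᵢ` is a finite sum of completely positive order zero maps from a finite-dimensional
C*-algebra `F` into `A`, then `τ ∘ φ` is a positive tracial functional on `F`.
In particular, for a single contractive completely positive order zero map `φ₀`, the
functional `τ ∘ φ₀` is of norm at most `1`. -/
theorem trace_comp_sum_orderZero_tracial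
    {F A : Type*}
    [NormedRing F] [StarRing F] [CStarRing F] [NormedAlgebra ℂ F] [FiniteDimensional ℂ F]
    [NormedRing A] [StarRing A] [CStarRing A] [NormedAlgebra ℂ A] [CompleteSpace A]
    (τ : A →ₗ[ℂ] ℂ)
    (hτpos : ∀ a : A, 0 ≤ (τ (star a * a)).re ∧ (τ (star a * a)).im = 0)
    (hτtr : ∀ a b : A, τ (a * b) = τ (b * a)) (hτ1 : τ 1 = 1)
    (m : ℕ) (φ : Fin m → (F →ₗ[ℂ] A))
    (hφ : ∀ i, IsCompletelyPositive (φ i) ∧ IsOrderZero ⇑(φ i)) :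
    (∀ x : F, (∃ c, x = star c * c) →
        0 ≤ (τ (∑ i, φ i x)).re ∧ (τ (∑ i, φ i x)).im = 0) ∧
    (∀ x y : F, τ (∑ i, φ i (x * y)) = τ (∑ i, φ i (y * x))) ∧
    (∀ φ₀ : F →ₗ[ℂ] A, IsCompletelyPositive φ₀ → IsOrderZero ⇑φ₀ →
      (∀ z : F, ‖φ₀ z‖ ≤ ‖z‖) →
      ∀ x : F, ‖x‖ ≤ 1 → ‖τ (φ₀ x)‖ ≤ 1) := by
  refine ⟨?_, ?_, ?_⟩
  · intro x hx
    have hi : ∀ i, 0 ≤ (τ (φ i x)).re ∧ (τ (φ i x)).im = 0 := by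
      intro i
      obtain ⟨c, rfl⟩ := hx
      obtain ⟨N, hN⟩ := (hφ i).1 1 _ ⟨!![c], rfl⟩
      have e := congrFun (congrFun hN 0) 0
      simp [Matrix.mul_apply, Matrix.conjTranspose_apply] at e
      rw [e]
      exact hτpos _
    rw [map_sum, Complex.re_sum, Complex.im_sum]
    exact ⟨Finset.sum_nonneg fun i _ => (hi i).1, Finset.sum_eq_zero fun i _ => (hi i).2⟩
  · intro x y
    rw [map_sum, map_sum]
    refine Finset.sum_congr rfl fun i _ => ?_
    have : IsSemisimpleRing F := aux_semisimple
    obtain ⟨n, d, -, ⟨e⟩⟩ := IsSemisimpleRing.exists_algEquiv_pi_matrix_of_isAlgClosed ℂ F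
    have h := aux_pi_tracial (τ ∘ₗ φ i ∘ₗ e.symm.toLinearMap) (by
      intro u v huv
      have := aux_zero_prod τ hτpos hτtr hτ1 (φ i) (hφ i).1 (hφ i).2 (e.symm u) (e.symm v)
        (by rw [← map_mul, huv, map_zero])
      simpa using this) (e x) (e y)
    simpa using h
  · intro φ₀ _ _ hc x hx
    exact aux_norm τ hτpos hτ1 _ ((hc x).trans hx)
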